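/- arXiv:1906.06261 — 2 statements merged into one kernel-verified Lean document; each statement's English description precedes it below -/
import Mathlib

section
/- Let (X,d) be a cone metric space over a Banach algebra A with solid cone P, let X_n (n ∈ ℕ) and X_∞ be nonempty subsets of X, and let T_n : X_n → X and T_∞ : X_∞ → X be maps such that: (i) each T_n is a k-contraction w.r.t. d for a common k ∈ P with ρ(k) < 1; (ii) the family (T_n) has property (G) with (G)-limit T_∞; (iii) x_∞ is a fixed point of T_∞, and each T_n has a fixed point x_n. Then (d(x_n, x_∞))_{n∈ℕ} is a c-sequence. -/
open Filter Topology

/-- Spectral radius via the Gelfand formula: `inf_{n ≥ 1} ‖k ^ n‖ ^ (1 / n)`. -/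
noncomputable def specRad {A : Type*} [NormedRing A] (k : A) : ℝ :=
  ⨅ n : ℕ, ‖k ^ (n + 1)‖ ^ ((1 : ℝ) / (n + 1))

/-- A cone in a real Banach algebra `A`: a nonempty closed subset containing `0` and `1`,
closed under nonnegative real combinations and multiplication, with `P ∩ (-P) = {0}`. -/
structure IsCone {A : Type*} [NormedRing A] [NormedAlgebra ℝ A] (P : Set A) : Prop where
  closed : IsClosed P
  zero_mem : (0 : A) ∈ P
  one_mem : (1 : A) ∈ P
  smul_mem : ∀ a : ℝ, 0 ≤ a → ∀ x ∈ P, a • x ∈ P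
  add_mem : ∀ x ∈ P, ∀ y ∈ P, x + y ∈ P
  mul_mem : ∀ x ∈ P, ∀ y ∈ P, x * y ∈ P
  antisymm : ∀ x ∈ P, -x ∈ P → x = 0

/-- A c-sequence with respect to the solid cone `P`: for every `c ≫ 0` eventually `u n ≪ c`. -/
def CSeq {A : Type*} [NormedRing A] [NormedAlgebra ℝ A] (P : Set A) (u : ℕ → A) : Prop :=
  ∀ c : A, c ∈ interior P → ∃ N : ℕ, ∀ n ≥ N, c - u n ∈ interior P

/-- A cone metric on `X` over the Banach algebra `A` with cone `P`. -/
structure IsConeMetric {A : Type*} [NormedRing A] [NormedAlgebra ℝ A] (P : Set A)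
    {X : Type*} (d : X → X → A) : Prop where
  mem_cone : ∀ x y, d x y ∈ P
  eq_zero_iff : ∀ x y, d x y = 0 ↔ x = y
  symm : ∀ x y, d x y = d y x
  triangle : ∀ x y z, d x y + d y z - d x z ∈ P

/-- Completeness of a cone metric space over a Banach algebra:
every Cauchy sequence converges (in the c-sequence sense). -/
def ConeComplete {A : Type*} [NormedRing A] [NormedAlgebra ℝ A] (P : Set A)
    {X : Type*} (d : X → X → A) : Prop :=
  ∀ u : ℕ → X,
    (∀ c : A, c ∈ interior P → ∃ N : ℕ, ∀ m ≥ N, ∀ n ≥ N, c - d (u m) (u n) ∈ interior P) →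
    ∃ x : X, CSeq P fun n => d (u n) x

/-- `Tinf` is a (G)-limit of the family `T` (property (G)). -/
def GLimit {A : Type*} [NormedRing A] [NormedAlgebra ℝ A] (P : Set A)
    {X : Type*} (d : X → X → A) (Xn : ℕ → Set X) (Xinf : Set X)
    (T : ℕ → X → X) (Tinf : X → X) : Prop :=
  ∀ x ∈ Xinf, ∃ u : ℕ → X, (∀ n, u n ∈ Xn n) ∧
    CSeq P (fun n => d (u n) x) ∧ CSeq P (fun n => d (T n (u n)) (Tinf x))

/-- `Tinf` is an (H)-limit of the family `T` (property (H)). -/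
def HLimit {A : Type*} [NormedRing A] [NormedAlgebra ℝ A] (P : Set A)
    {X : Type*} (d : X → X → A) (Xn : ℕ → Set X) (Xinf : Set X)
    (T : ℕ → X → X) (Tinf : X → X) : Prop :=
  ∀ u : ℕ → X, (∀ n, u n ∈ Xn n) → ∃ v : ℕ → X, (∀ n, v n ∈ Xinf) ∧
    CSeq P (fun n => d (u n) (v n)) ∧ CSeq P (fun n => d (T n (u n)) (Tinf (v n)))

namespace IsCone

variable {A : Type*} [NormedRing A] [NormedAlgebra ℝ A] {P : Set A}

theorem pow_mem (hP : IsCone P) {k : A} (hk : k ∈ P) (n : ℕ) : k ^ n ∈ P := by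
  induction n with
  | zero => simpa using hP.one_mem
  | succ n ih => rw [pow_succ]; exact hP.mul_mem _ ih _ hk

theorem sum_mem (hP : IsCone P) {ι : Type*} (s : Finset ι) {f : ι → A} (hf : ∀ i, f i ∈ P) :
    ∑ i ∈ s, f i ∈ P :=
  Finset.sum_induction f (· ∈ P) (fun a b ha hb => hP.add_mem a ha b hb) hP.zero_mem
    fun i _ => hf i

theorem tsum_mem (hP : IsCone P) {ι : Type*} {f : ι → A} (hs : Summable f)
    (hf : ∀ i, f i ∈ P) : ∑' i, f i ∈ P :=
  hP.closed.mem_of_tendsto hs.hasSum (Eventually.of_forall fun s => hP.sum_mem s hf)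

theorem interior_add_mem (hP : IsCone P) {x y : A} (hx : x ∈ interior P) (hy : y ∈ P) :
    x + y ∈ interior P := by
  refine interior_maximal ?_ (isOpen_interior.add_right (t := P)) (Set.add_mem_add hx hy)
  rintro _ ⟨a, ha, b, hb, rfl⟩
  exact hP.add_mem a (interior_subset ha) b hb

theorem smul_mem_interior (hP : IsCone P) {x : A} (hx : x ∈ interior P) {r : ℝ} (hr : 0 < r) :
    r • x ∈ interior P := by
  have hopen : IsOpen ((fun y : A => r⁻¹ • y) ⁻¹' interior P) :=
    isOpen_interior.preimage (continuous_const_smul _)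
  refine interior_maximal (fun y hy => ?_) hopen ?_
  · have h := hP.smul_mem r hr.le _ (interior_subset hy)
    rwa [smul_inv_smul₀ hr.ne'] at h
  · simpa [inv_smul_smul₀ hr.ne'] using hx

end IsCone

namespace CSeq

variable {A : Type*} [NormedRing A] [NormedAlgebra ℝ A] {P : Set A} {u v : ℕ → A}

theorem of_sub_mem (hP : IsCone P) (hv : CSeq P v) (h : ∀ n, v n - u n ∈ P) : CSeq P u := by
  intro c hc
  obtain ⟨N, hN⟩ := hv c hc
  refine ⟨N, fun n hn => ?_⟩
  have := hP.interior_add_mem (hN n hn) (h n)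
  rwa [sub_add_sub_cancel] at this

theorem add (hP : IsCone P) (hu : CSeq P u) (hv : CSeq P v) : CSeq P fun n => u n + v n := by
  intro c hc
  have hc2 := hP.smul_mem_interior hc (r := 1 / 2) (by norm_num)
  obtain ⟨N, hN⟩ := hu _ hc2
  obtain ⟨M, hM⟩ := hv _ hc2
  refine ⟨max N M, fun n hn => ?_⟩
  have := hP.interior_add_mem (hN n (le_of_max_le_left hn))
    (interior_subset (hM n (le_of_max_le_right hn)))
  rwa [sub_add_sub_comm, ← add_smul, add_halves, one_smul] at this

theorem mul_left (hP : IsCone P) {q : A} (hq : q ∈ P) (hu : CSeq P u) :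
    CSeq P fun n => q * u n := by
  intro c hc
  have hlim : Tendsto (fun r : ℝ => c - q * r • c) (𝓝[>] 0) (𝓝 c) := by
    have : Continuous fun r : ℝ => c - q * r • c := by fun_prop
    simpa using (this.tendsto 0).mono_left nhdsWithin_le_nhds
  obtain ⟨r, hr, hr0⟩ :=
    ((hlim.eventually (isOpen_interior.mem_nhds hc)).and self_mem_nhdsWithin).exists
  obtain ⟨N, hN⟩ := hu _ (hP.smul_mem_interior hc hr0)
  refine ⟨N, fun n hn => ?_⟩
  have := hP.interior_add_mem hr (hP.mul_mem q hq _ (interior_subset (hN n hn)))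
  rwa [mul_sub, sub_add_sub_cancel] at this

end CSeq

theorem exists_norm_pow_lt_one_of_specRad_lt_one {A : Type*} [NormedRing A] {k : A}
    (hρ : specRad k < 1) : ∃ n : ℕ, ‖k ^ n‖ < 1 := by
  obtain ⟨n, hn⟩ := exists_lt_of_ciInf_lt hρ
  refine ⟨n + 1, ?_⟩
  by_contra! h
  exact hn.not_ge (Real.one_le_rpow h (by positivity))

/-- The left inverse of `1 - k` given by the Neumann series lies in the cone. -/
theorem IsCone.exists_mul_one_sub_eq_one {A : Type*} [NormedRing A] [NormedAlgebra ℝ A]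
    [CompleteSpace A] {P : Set A} (hP : IsCone P) {k : A} (hk : k ∈ P) (hρ : specRad k < 1) :
    ∃ q ∈ P, q * (1 - k) = 1 := by
  obtain ⟨m, hm⟩ := exists_norm_pow_lt_one_of_specRad_lt_one hρ
  refine ⟨(∑' i, (k ^ m) ^ i) * ∑ i ∈ Finset.range m, k ^ i, hP.mul_mem _ ?_ _ ?_, ?_⟩
  · exact hP.tsum_mem (summable_geometric_of_norm_lt_one hm)
      fun i => hP.pow_mem (hP.pow_mem hk m) i
  · exact hP.sum_mem _ fun i => hP.pow_mem hk i
  · rw [mul_assoc, geom_sum_mul_neg, geom_series_mul_neg _ hm]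

/-- If each `T n` is a `k`-contraction, the family `(T n)` has property (G) with (G)-limit
`T∞`, `x∞` is a fixed point of `T∞` and each `T n` has a fixed point `x n`, then
`(d (x n) x∞)` is a c-sequence. -/
theorem fixedPoints_cSeq_of_gLimit {A : Type*} [NormedRing A] [NormedAlgebra ℝ A]
    [CompleteSpace A] {X : Type*} (P : Set A) (hP : IsCone P) (hsolid : (interior P).Nonempty)
    (d : X → X → A) (hd : IsConeMetric P d)
    (Xn : ℕ → Set X) (hXn : ∀ n, (Xn n).Nonempty) (Xinf : Set X) (hXinf : Xinf.Nonempty)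
    (T : ℕ → X → X) (Tinf : X → X)
    (k : A) (hk : k ∈ P) (hρ : specRad k < 1)
    (hcontr : ∀ n, ∀ x ∈ Xn n, ∀ y ∈ Xn n, k * d x y - d (T n x) (T n y) ∈ P)
    (hG : GLimit P d Xn Xinf T Tinf)
    (x : ℕ → X) (hx : ∀ n, x n ∈ Xn n) (hfix : ∀ n, T n (x n) = x n)
    (xinf : X) (hxinf : xinf ∈ Xinf) (hfixinf : Tinf xinf = xinf) :
    CSeq P fun n => d (x n) xinf := by
  obtain ⟨y, hy, ha, hb⟩ := hG xinf hxinf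
  obtain ⟨q, hq, hqk⟩ := hP.exists_mul_one_sub_eq_one hk hρ
  refine ((ha.mul_left hP hk).add hP hb |>.mul_left hP hq).of_sub_mem hP fun n => ?_
  have h₁ := hd.triangle (x n) (T n (y n)) xinf
  have h₂ := hcontr n (x n) (hx n) (y n) (hy n)
  have h₃ := hP.mul_mem k hk _ (hd.triangle (x n) xinf (y n))
  rw [hfix] at h₂
  rw [hd.symm xinf] at h₃
  have h := hP.mul_mem q hq _ (hP.add_mem _ (hP.add_mem _ h₁ _ h₂) _ h₃)
  have hδ : d (x n) xinf = q * ((1 - k) * d (x n) xinf) := by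
    rw [← mul_assoc, hqk, one_mul]
  rw [hfixinf, hδ, ← mul_sub]
  convert h using 2
  noncomm_ring
end

section
/- Let (X,d) be a cone metric space over a Banach algebra A with solid cone P, let M be a nonempty subset of X, and let T_n, T_∞ : M → X be maps. If T_∞ is an (H)-limit of the family (T_n) (with X_n = X_∞ = M) and T_∞ is uniformly continuous on M w.r.t. d (i.e. for every c₁ with θ ≪ c₁ there exists c₂ with θ ≪ c₂ such that for all x, y ∈ M with d(x,y) ≪ c₂ one has d(T_∞ x, T_∞ y) ≪ c₁), then T_n converges uniformly to T_∞ on M w.r.t. d. -/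
open Filter Topology

theorem IsCone.add_mem_interior {A : Type*} [NormedRing A] [NormedAlgebra ℝ A] {P : Set A}
    (hP : IsCone P) {x y : A} (hx : x ∈ interior P) (hy : y ∈ P) : x + y ∈ interior P := by
  have hsub : (fun z => z + y) '' interior P ⊆ interior P :=
    interior_maximal (by rintro _ ⟨z, hz, rfl⟩; exact hP.add_mem z (interior_subset hz) y hy)
      (isOpenMap_add_right y _ isOpen_interior)
  exact hsub ⟨x, hx, rfl⟩

theorem IsCone.smul_mem_interior_s11 {A : Type*} [NormedRing A] [NormedAlgebra ℝ A] {P : Set A}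
    (hP : IsCone P) {a : ℝ} (ha : 0 < a) {x : A} (hx : x ∈ interior P) :
    a • x ∈ interior P := by
  have hsub : (fun z => a • z) '' interior P ⊆ interior P :=
    interior_maximal (by rintro _ ⟨z, hz, rfl⟩; exact hP.smul_mem a ha.le z (interior_subset hz))
      (isOpenMap_smul₀ ha.ne' _ isOpen_interior)
  exact hsub ⟨x, hx, rfl⟩

/-- If `T∞` is an (H)-limit of the family `(T n)` (with `X n = X∞ = M`) and `T∞` is
uniformly continuous on `M` with respect to the cone metric, then `T n` converges uniformly
to `T∞` on `M`. -/
theorem uniform_convergence_of_hLimit {A : Type*} [NormedRing A] [NormedAlgebra ℝ A]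
    [CompleteSpace A] {X : Type*} (P : Set A) (hP : IsCone P) (hsolid : (interior P).Nonempty)
    (d : X → X → A) (hd : IsConeMetric P d)
    (M : Set X) (hM : M.Nonempty) (T : ℕ → X → X) (Tinf : X → X)
    (hH : HLimit P d (fun _ => M) M T Tinf)
    (hucont : ∀ c₁ ∈ interior P, ∃ c₂ ∈ interior P, ∀ x ∈ M, ∀ y ∈ M,
      c₂ - d x y ∈ interior P → c₁ - d (Tinf x) (Tinf y) ∈ interior P) :
    ∀ c : A, c ∈ interior P → ∃ N : ℕ, ∀ n ≥ N, ∀ x ∈ M,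
      c - d (T n x) (Tinf x) ∈ interior P := by
  intro c hc
  have hhalf : (1 / 2 : ℝ) • c ∈ interior P := hP.smul_mem_interior_s11 (by norm_num) hc
  have hworst : ∀ n, ∃ x ∈ M, c - d (T n x) (Tinf x) ∈ interior P →
      ∀ y ∈ M, c - d (T n y) (Tinf y) ∈ interior P := by
    intro n
    by_cases h : ∀ y ∈ M, c - d (T n y) (Tinf y) ∈ interior P
    · obtain ⟨x, hx⟩ := hM
      exact ⟨x, hx, fun _ => h⟩
    · push Not at h
      obtain ⟨x, hx, hbad⟩ := h
      exact ⟨x, hx, fun hgood => absurd hgood hbad⟩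
  choose u huM hu using hworst
  obtain ⟨v, hvM, huv, hTuv⟩ := hH u huM
  obtain ⟨c₂, hc₂, hcont⟩ := hucont _ hhalf
  obtain ⟨N₁, hN₁⟩ := huv c₂ hc₂
  obtain ⟨N₂, hN₂⟩ := hTuv _ hhalf
  refine ⟨max N₁ N₂, fun n hn => hu n ?_⟩
  have h₁ := hcont _ (huM n) _ (hvM n) (hN₁ n (le_of_max_le_left hn))
  have h₂ := hN₂ n (le_of_max_le_right hn)
  have h := hP.add_mem_interior (hP.add_mem_interior h₂ (interior_subset h₁))
    (hd.triangle (T n (u n)) (Tinf (v n)) (Tinf (u n)))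
  have hc_split : c = (1 / 2 : ℝ) • c + (1 / 2 : ℝ) • c := by
    rw [← add_smul]
    norm_num
  rw [hd.symm (Tinf (v n))] at h
  convert h using 1
  nth_rewrite 1 [hc_split]
  abel
end
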